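/- arXiv:2205.11222 — 2 statements merged into one kernel-verified Lean document; each statement's English description precedes it below -/
import Mathlib

section
/- Let V be a finite-dimensional complex vector space and let H, P, c be linear endomorphisms of V with P² = 1, c² = 1, HP = PH, Hc = cH and Pc = −cP. Then every eigenspace of H has even dimension. (Applied to H = H_g, P the fermion parity and c = c_{2N}, this gives the two-fold degeneracy of every energy level of the interacting Majorana chain.) -/
/-- If `H`, `P`, `c` are endomorphisms of a finite-dimensional complex vector space with
`P² = 1`, `c² = 1`, `HP = PH`, `Hc = cH` and `Pc = -cP`, then every eigenspace of `H` has
even dimension.  (Applied to the interacting Majorana chain with `P` the fermion parity and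
`c = c_{2N}`, this gives the two-fold degeneracy of every energy level.) -/
theorem stmt4 {V : Type*} [AddCommGroup V] [Module ℂ V] [FiniteDimensional ℂ V]
    (H P c : Module.End ℂ V)
    (hP : P * P = 1) (hc : c * c = 1)
    (hHP : H * P = P * H) (hHc : H * c = c * H) (hPc : P * c = -(c * P)) :
    ∀ μ : ℂ, Even (Module.finrank ℂ (Module.End.eigenspace H μ)) := by
  intro μ
  have key : ∀ A : Module.End ℂ V, H * A = A * H →
      ∀ x ∈ Module.End.eigenspace H μ, A x ∈ Module.End.eigenspace H μ := by
    intro A hA x hx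
    rw [Module.End.mem_eigenspace_iff] at hx ⊢
    have h := LinearMap.congr_fun hA x
    simp only [Module.End.mul_apply] at h
    rw [h, hx, map_smul]
  let Q : Module.End ℂ (Module.End.eigenspace H μ) := P.restrict (key P hHP)
  let d : Module.End ℂ (Module.End.eigenspace H μ) := c.restrict (key c hHc)
  have hQ : Q * Q = 1 := by
    ext x
    exact LinearMap.congr_fun hP (x : V)
  have hd : d * d = 1 := by
    ext x
    exact LinearMap.congr_fun hc (x : V)
  have hQd : Q * d = (-1 : ℂ) • (d * Q) := by
    ext x
    have h : P (c (x : V)) = -(c (P (x : V))) := LinearMap.congr_fun hPc (x : V)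
    change P (c (x : V)) = (-1 : ℂ) • (c (P (x : V)))
    rw [h, neg_smul, one_smul]
  have h1 := congrArg LinearMap.det hQ
  have h2 := congrArg LinearMap.det hd
  have h3 := congrArg LinearMap.det hQd
  rw [map_mul, map_one] at h1 h2
  rw [LinearMap.det_smul, map_mul, map_mul] at h3
  rcases Nat.even_or_odd (Module.finrank ℂ (Module.End.eigenspace H μ)) with h | h
  · exact h
  · exfalso
    rw [h.neg_one_pow] at h3
    have h4 : (LinearMap.det Q * LinearMap.det Q) * (LinearMap.det d * LinearMap.det d) = 1 := by
      rw [h1, h2, one_mul]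
    have h5 : LinearMap.det Q * LinearMap.det d = 0 := by linear_combination h3 / 2
    have h6 : (1 : ℂ) = 0 := by
      linear_combination (LinearMap.det Q * LinearMap.det d) * h5 - h4
    exact one_ne_zero h6
end

section
/- Let V be a finite-dimensional complex inner product space, let H₀ and W be self-adjoint endomorphisms of V, and let Δ > 0, g̃ > 0 be real numbers with 2√2 g̃ < Δ. Assume the operator inequality W² ≤ 2 g̃² (1 + Δ⁻² H₀²), i.e. ⟨φ, W²φ⟩ ≤ 2 g̃² (‖φ‖² + Δ⁻² ⟨φ, H₀²φ⟩) for all φ ∈ V. Suppose ψ ∈ V is a unit vector with (H₀ + W)ψ = E₁ ψ for a real number E₁ satisfying |E₁| ≤ Δ. Then ⟨ψ, (E₁ − H₀)² ψ⟩ ≤ 4 Δ g̃² / (Δ − 2√2 g̃). (This is the key quantitative estimate in the proof that the spectral gap above the two-fold degenerate ground state survives weak even-parity perturbations.) -/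
open scoped ComplexInnerProductSpace

/-- Key quantitative gap-stability estimate: if `H₀`, `W` are self-adjoint with
`W² ≤ 2 g̃² (1 + Δ⁻² H₀²)`, `2√2 g̃ < Δ`, and `ψ` is a unit eigenvector of `H₀ + W` with
eigenvalue `E₁`, `|E₁| ≤ Δ`, then `⟨ψ, (E₁ - H₀)² ψ⟩ ≤ 4 Δ g̃² / (Δ - 2√2 g̃)`. -/
theorem stmt19 {V : Type*} [NormedAddCommGroup V] [InnerProductSpace ℂ V]
    [FiniteDimensional ℂ V]
    (H₀ W : V →ₗ[ℂ] V)
    (hH₀sa : ∀ x y : V, ⟪H₀ x, y⟫ = ⟪x, H₀ y⟫)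
    (hWsa : ∀ x y : V, ⟪W x, y⟫ = ⟪x, W y⟫)
    (Δ g : ℝ) (hΔ : 0 < Δ) (hg : 0 < g) (hgΔ : 2 * Real.sqrt 2 * g < Δ)
    (hW2 : ∀ φ : V, (⟪φ, W (W φ)⟫).re
      ≤ 2 * g ^ 2 * (‖φ‖ ^ 2 + Δ⁻¹ ^ 2 * (⟪φ, H₀ (H₀ φ)⟫).re))
    (ψ : V) (hψ : ‖ψ‖ = 1) (E₁ : ℝ)
    (hE : (H₀ + W) ψ = (E₁ : ℂ) • ψ) (hE₁ : |E₁| ≤ Δ)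
    (A : V →ₗ[ℂ] V) (hA : A = (E₁ : ℂ) • (LinearMap.id : V →ₗ[ℂ] V) - H₀) :
    (⟪ψ, A (A ψ)⟫).re ≤ 4 * Δ * g ^ 2 / (Δ - 2 * Real.sqrt 2 * g) := by
  have hAψ : A ψ = W ψ := by
    rw [hA, LinearMap.sub_apply, LinearMap.smul_apply, LinearMap.id_apply, ← hE]
    simp
  have hAsa : ∀ x y : V, ⟪A x, y⟫ = ⟪x, A y⟫ := by
    intro x y
    rw [hA]
    simp [inner_sub_left, inner_sub_right, inner_smul_left, inner_smul_right, hH₀sa]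
  have hn : ∀ v : V, (⟪v, v⟫).re = ‖v‖ ^ 2 := by
    intro v
    rw [inner_self_eq_norm_sq_to_K]
    norm_cast
  have h1 := hW2 ψ
  rw [← hWsa, ← hH₀sa, hn, hn, hψ] at h1
  rw [← hAsa, hAψ, hn]
  have hH : ‖H₀ ψ‖ ≤ Δ + ‖W ψ‖ := by
    have h : H₀ ψ = (E₁ : ℂ) • ψ - W ψ := by
      rw [← hE]; simp
    rw [h]
    refine (norm_sub_le _ _).trans ?_
    rw [norm_smul, hψ, Complex.norm_real, Real.norm_eq_abs]
    linarith
  have hH2 : ‖H₀ ψ‖ ^ 2 ≤ (Δ + ‖W ψ‖) ^ 2 := by gcongr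
  have hx : 0 ≤ ‖W ψ‖ := norm_nonneg _
  generalize ‖W ψ‖ = x at *
  generalize ‖H₀ ψ‖ ^ 2 = q at *
  obtain ⟨u, hu⟩ : ∃ u, u = Real.sqrt 2 * g := ⟨_, rfl⟩
  have hu0 : 0 < u := by rw [hu]; positivity
  have hu2 : 2 * g ^ 2 = u ^ 2 := by
    rw [hu, mul_pow, Real.sq_sqrt (by norm_num)]
  have e : 2 * Real.sqrt 2 * g = 2 * u := by rw [hu]; ring
  rw [e] at hgΔ ⊢
  rw [hu2] at h1
  have h2 : x ^ 2 * Δ ^ 2 ≤ u ^ 2 * (2 * Δ ^ 2 + 2 * Δ * x + x ^ 2) := by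
    have h3 : x ^ 2 * Δ ^ 2 ≤ u ^ 2 * (1 ^ 2 + Δ⁻¹ ^ 2 * q) * Δ ^ 2 := by gcongr
    have h4 : u ^ 2 * (1 ^ 2 + Δ⁻¹ ^ 2 * q) * Δ ^ 2 = u ^ 2 * (Δ ^ 2 + q) := by
      field_simp
    have h5 : u ^ 2 * q ≤ u ^ 2 * (Δ + x) ^ 2 := by gcongr
    nlinarith
  have h6 : 4 * Δ * g ^ 2 = 2 * Δ * u ^ 2 := by rw [← hu2]; ring
  rw [h6, le_div_iff₀ (by linarith)]
  refine le_of_mul_le_mul_left ?_ hΔ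
  rcases le_or_gt (2 * u * Δ) (x * (2 * Δ - u)) with h | h
  · have h7 := mul_le_mul_of_nonneg_left h (mul_nonneg hu0.le hx)
    nlinarith
  · have h8 : 0 ≤ x * (2 * Δ - u) := mul_nonneg hx (by linarith)
    have h9 : (x * (2 * Δ - u)) ^ 2 ≤ (2 * u * Δ) ^ 2 := by gcongr
    have h10 : 0 ≤ x ^ 2 * (2 * Δ ^ 2 + u ^ 2) := by positivity
    nlinarith
end
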